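/- The set C of right endpoints of bounded complementary intervals of K, ordered by the usual order < of ℝ, is a countably infinite dense linear order without endpoints: C is countably infinite, for all a < b in C there is c ∈ C with a < c < b, and C has no least and no greatest element. Consequently there exists an order isomorphism from (C,<) onto (ℚ,<). -/

import Mathlib

open Set

/-- A Cantor set: a nonempty compact subset of `ℝ` with no isolated points and
empty interior. -/
def IsCantorSet (K : Set ℝ) : Prop :=
  K.Nonempty ∧ IsCompact K ∧ (∀ x ∈ K, x ∈ closure (K \ {x})) ∧ interior K = ∅

/-- For a closed set `K ⊆ ℝ`, `Ioo u v` is a bounded connected component of `ℝ \ K`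
(a bounded complementary interval of `K`) iff `u < v`, `Ioo u v` misses `K`, and
both endpoints belong to `K`. -/
def IsBddCompInterval (K : Set ℝ) (u v : ℝ) : Prop :=
  u < v ∧ Ioo u v ∩ K = ∅ ∧ u ∈ K ∧ v ∈ K

/-- The set of right endpoints of bounded complementary intervals of `K`. -/
def rightEndpoints (K : Set ℝ) : Set ℝ :=
  {v | ∃ u, IsBddCompInterval K u v}

theorem IsBddCompInterval.le_left {K : Set ℝ} {u v x : ℝ} (h : IsBddCompInterval K u v)
    (hx : x ∈ K) (hxv : x < v) : x ≤ u := by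
  by_contra! hux
  exact eq_empty_iff_forall_notMem.mp h.2.1 x ⟨⟨hux, hxv⟩, hx⟩

theorem IsBddCompInterval.right_le {K : Set ℝ} {u v x : ℝ} (h : IsBddCompInterval K u v)
    (hx : x ∈ K) (hux : u < x) : v ≤ x := by
  by_contra! hxv
  exact eq_empty_iff_forall_notMem.mp h.2.1 x ⟨⟨hux, hxv⟩, hx⟩

theorem IsCantorSet.exists_mem_Ioo_ne {K : Set ℝ} (hK : IsCantorSet K) {x a b : ℝ} (hx : x ∈ K)
    (hax : a < x) (hxb : x < b) : ∃ y ∈ K, y ≠ x ∧ a < y ∧ y < b := by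
  obtain ⟨y, hy, hyK, hyx⟩ :=
    mem_closure_iff.mp (hK.2.2.1 x hx) (Ioo a b) isOpen_Ioo ⟨hax, hxb⟩
  exact ⟨y, hyK, hyx, hy.1, hy.2⟩

theorem IsCantorSet.exists_rightEndpoint_mem_Ioc {K : Set ℝ} (hK : IsCantorSet K) {x y : ℝ}
    (hx : x ∈ K) (hy : y ∈ K) (hxy : x < y) : ∃ c ∈ rightEndpoints K, x < c ∧ c ≤ y := by
  obtain ⟨-, hcomp, -, hint⟩ := hK
  obtain ⟨t, ht, htK⟩ : ∃ t ∈ Ioo x y, t ∉ K := by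
    by_contra! h
    have hsub : Ioo x y ⊆ interior K := interior_maximal h isOpen_Ioo
    rw [hint] at hsub
    exact (nonempty_Ioo.mpr hxy).ne_empty (subset_empty_iff.mp hsub)
  obtain ⟨u, ⟨huK, hut⟩, hu⟩ :=
    (hcomp.inter_right isClosed_Iic).exists_isGreatest ⟨x, hx, ht.1.le⟩
  obtain ⟨v, ⟨hvK, htv⟩, hv⟩ :=
    (hcomp.inter_right isClosed_Ici).exists_isLeast ⟨y, hy, ht.2.le⟩
  have hut' : u < t := lt_of_le_of_ne hut fun h => htK (h ▸ huK)
  have htv' : t < v := lt_of_le_of_ne htv fun h => htK (h ▸ hvK)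
  refine ⟨v, ⟨u, hut'.trans htv', ?_, huK, hvK⟩, ht.1.trans htv', hv ⟨hy, ht.2.le⟩⟩
  refine eq_empty_iff_forall_notMem.mpr fun z ⟨hz, hzK⟩ => ?_
  rcases le_total z t with h | h
  · exact hz.1.not_ge (hu ⟨hzK, h⟩)
  · exact hz.2.not_ge (hv ⟨hzK, h⟩)

theorem countable_rightEndpoints (K : Set ℝ) : (rightEndpoints K).Countable := by
  refine (countable_setOfPred_isolated_left_within (s := K)).mono ?_
  rintro v ⟨u, huv, hd, -, hv⟩
  refine ⟨hv, Filter.empty_mem_iff_bot.mp (mem_nhdsWithin.mpr ⟨Ioi u, isOpen_Ioi, huv, ?_⟩)⟩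
  rintro z ⟨huz, hzK, hzv⟩
  exact hd.subset ⟨⟨huz, hzv⟩, hzK⟩

theorem IsCantorSet.rightEndpoints_nonempty {K : Set ℝ} (hK : IsCantorSet K) :
    (rightEndpoints K).Nonempty := by
  obtain ⟨x, hx⟩ := hK.1
  obtain ⟨y, hy, hyx, -, -⟩ := hK.exists_mem_Ioo_ne hx (sub_one_lt x) (lt_add_one x)
  rcases lt_or_gt_of_ne hyx with h | h
  · obtain ⟨c, hc, -⟩ := hK.exists_rightEndpoint_mem_Ioc hy hx h
    exact ⟨c, hc⟩
  · obtain ⟨c, hc, -⟩ := hK.exists_rightEndpoint_mem_Ioc hx hy h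
    exact ⟨c, hc⟩

theorem IsCantorSet.exists_rightEndpoint_between {K : Set ℝ} (hK : IsCantorSet K) {a b : ℝ}
    (ha : a ∈ rightEndpoints K) (hb : b ∈ rightEndpoints K) (hab : a < b) :
    ∃ c ∈ rightEndpoints K, a < c ∧ c < b := by
  obtain ⟨w, hwa⟩ := ha
  obtain ⟨u, hub⟩ := hb
  have haK : a ∈ K := hwa.2.2.2
  obtain ⟨x, hx, hxa, hwx, hxb⟩ := hK.exists_mem_Ioo_ne haK hwa.1 hab
  have hau : a < u :=
    (lt_of_le_of_ne (hwa.right_le hx hwx) hxa.symm).trans_le (hub.le_left hx hxb)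
  obtain ⟨c, hc, hac, hcu⟩ := hK.exists_rightEndpoint_mem_Ioc haK hub.2.2.1 hau
  exact ⟨c, hc, hac, hcu.trans_lt hub.1⟩

theorem IsCantorSet.exists_rightEndpoint_lt {K : Set ℝ} (hK : IsCantorSet K) {a : ℝ}
    (ha : a ∈ rightEndpoints K) : ∃ b ∈ rightEndpoints K, b < a := by
  obtain ⟨u, hua⟩ := ha
  obtain ⟨x, hx, hxu, -, hxa⟩ := hK.exists_mem_Ioo_ne hua.2.2.1 (sub_one_lt u) hua.1
  obtain ⟨c, hc, -, hcu⟩ := hK.exists_rightEndpoint_mem_Ioc hx hua.2.2.1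
    (lt_of_le_of_ne (hua.le_left hx hxa) hxu)
  exact ⟨c, hc, hcu.trans_lt hua.1⟩

theorem IsCantorSet.exists_rightEndpoint_gt {K : Set ℝ} (hK : IsCantorSet K) {a : ℝ}
    (ha : a ∈ rightEndpoints K) : ∃ b ∈ rightEndpoints K, a < b := by
  obtain ⟨u, hua⟩ := ha
  obtain ⟨x, hx, hxa, hux, -⟩ := hK.exists_mem_Ioo_ne hua.2.2.2 hua.1 (lt_add_one a)
  obtain ⟨c, hc, hac, -⟩ := hK.exists_rightEndpoint_mem_Ioc hua.2.2.2 hx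
    (lt_of_le_of_ne (hua.right_le hx hux) hxa.symm)
  exact ⟨c, hc, hac⟩

theorem stmt6 (K : Set ℝ) (hK : IsCantorSet K) :
    (rightEndpoints K).Countable ∧
    (rightEndpoints K).Infinite ∧
    (∀ a ∈ rightEndpoints K, ∀ b ∈ rightEndpoints K, a < b →
      ∃ c ∈ rightEndpoints K, a < c ∧ c < b) ∧
    (∀ a ∈ rightEndpoints K, ∃ b ∈ rightEndpoints K, b < a) ∧
    (∀ a ∈ rightEndpoints K, ∃ b ∈ rightEndpoints K, a < b) ∧
    Nonempty (↥(rightEndpoints K) ≃o ℚ) := by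
  have hcount := countable_rightEndpoints K
  have : Countable (rightEndpoints K) := hcount.to_subtype
  have : Nonempty (rightEndpoints K) := hK.rightEndpoints_nonempty.to_subtype
  have : DenselyOrdered (rightEndpoints K) := ⟨fun a b hab => by
    obtain ⟨c, hc, hac, hcb⟩ := hK.exists_rightEndpoint_between a.2 b.2 hab
    exact ⟨⟨c, hc⟩, hac, hcb⟩⟩
  have : NoMinOrder (rightEndpoints K) := ⟨fun a => by
    obtain ⟨b, hb, hba⟩ := hK.exists_rightEndpoint_lt a.2
    exact ⟨⟨b, hb⟩, hba⟩⟩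
  have : NoMaxOrder (rightEndpoints K) := ⟨fun a => by
    obtain ⟨b, hb, hab⟩ := hK.exists_rightEndpoint_gt a.2
    exact ⟨⟨b, hb⟩, hab⟩⟩
  exact ⟨hcount, infinite_coe_iff.mp NoMaxOrder.infinite,
    fun _ ha _ hb => hK.exists_rightEndpoint_between ha hb,
    fun _ => hK.exists_rightEndpoint_lt, fun _ => hK.exists_rightEndpoint_gt,
    Order.iso_of_countable_dense _ _⟩
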